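/- Let λ₀₁, λ₁₊, λ₁₋ ≥ 0 with λ₀₁ + λ₁₊ + λ₁₋ = 1, and let ρ = λ₀₁|01⟩⟨01| + λ₁₊|1+⟩⟨1+| + λ₁₋|1−⟩⟨1−| on ℂ² ⊗ ℂ², where |1±⟩ = |1⟩⊗|±⟩. Then for every ε with 0 < ε ≤ 1, the state ρ_ε = (1−ε)ρ + ε|ψ₊⟩⟨ψ₊| is entangled and δ(ρ, ρ_ε) ≤ ε; hence there are entangled states arbitrarily close to ρ. -/

import Mathlib

open Matrix Kronecker BigOperators
open scoped ComplexOrder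

noncomputable section

/-- A quantum state: positive semidefinite, trace one. -/
def IsState {n : Type*} [Fintype n] [DecidableEq n] (ρ : Matrix n n ℂ) : Prop :=
  ρ.PosSemidef ∧ ρ.trace = 1

/-- Separability on a bipartite system `ℂ^dA ⊗ ℂ^dB`. -/
def SeparableState {dA dB : ℕ} (ρ : Matrix (Fin dA × Fin dB) (Fin dA × Fin dB) ℂ) : Prop :=
  ∃ (m : ℕ) (p : Fin m → ℝ) (A : Fin m → Matrix (Fin dA) (Fin dA) ℂ)
    (B : Fin m → Matrix (Fin dB) (Fin dB) ℂ),
    (∀ k, 0 ≤ p k) ∧ (∑ k, p k) = 1 ∧ (∀ k, IsState (A k)) ∧ (∀ k, IsState (B k)) ∧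
    ρ = ∑ k, ((p k : ℂ) • (A k ⊗ₖ B k))

/-- An entangled state is a state that is not separable. -/
def EntangledState {dA dB : ℕ} (ρ : Matrix (Fin dA × Fin dB) (Fin dA × Fin dB) ℂ) : Prop :=
  IsState ρ ∧ ¬ SeparableState ρ

/-- Trace distance: half the sum of absolute values of the eigenvalues of `ρ - τ`. -/
def traceDist {n : Type*} [Fintype n] [DecidableEq n] (ρ τ : Matrix n n ℂ) : ℝ :=
  if h : (ρ - τ).IsHermitian then (1/2) * ∑ i, |h.eigenvalues i| else 0

/-- Standard basis vector of `ℂ^d`. -/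
def bv {d : ℕ} (a : ℕ) (h : a < d) : Fin d → ℂ := Pi.single ⟨a, h⟩ (1 : ℂ)

/-- Standard basis of `ℂ²`. -/
def ket2 (a : Fin 2) : Fin 2 → ℂ := Pi.single a 1

/-- Standard basis of `ℂ³`. -/
def ket3 (a : Fin 3) : Fin 3 → ℂ := Pi.single a 1

/-- `|+⟩ = (|0⟩+|1⟩)/√2`. -/
def ketPlus : Fin 2 → ℂ := (Real.sqrt 2 : ℂ)⁻¹ • (ket2 0 + ket2 1)

/-- `|−⟩ = (|0⟩−|1⟩)/√2`. -/
def ketMinus : Fin 2 → ℂ := (Real.sqrt 2 : ℂ)⁻¹ • (ket2 0 - ket2 1)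

/-- Kronecker product of vectors. -/
def vecKron {dA dB : ℕ} (v : Fin dA → ℂ) (w : Fin dB → ℂ) : Fin dA × Fin dB → ℂ :=
  fun p => v p.1 * w p.2

/-- `|ψ₊⟩ = (|01⟩+|10⟩)/√2`. -/
def psiPlus : Fin 2 × Fin 2 → ℂ :=
  (Real.sqrt 2 : ℂ)⁻¹ • (vecKron (ket2 0) (ket2 1) + vecKron (ket2 1) (ket2 0))

/-- `|φ₊⟩ = (|00⟩+|11⟩)/√2`. -/
def phiPlus : Fin 2 × Fin 2 → ℂ :=
  (Real.sqrt 2 : ℂ)⁻¹ • (vecKron (ket2 0) (ket2 0) + vecKron (ket2 1) (ket2 1))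

/-- The projector `|v⟩⟨v|`. -/
def proj {n : Type*} (v : n → ℂ) : Matrix n n ℂ := vecMulVec v (star v)

/-- Partial transpose on the first factor. -/
def PT {dA dB : ℕ} (ρ : Matrix (Fin dA × Fin dB) (Fin dA × Fin dB) ℂ) :
    Matrix (Fin dA × Fin dB) (Fin dA × Fin dB) ℂ :=
  Matrix.of fun p q => ρ (q.1, p.2) (p.1, q.2)

/-- `⟨v|M|w⟩`. -/
def braket {n : Type*} [Fintype n] (v : n → ℂ) (M : Matrix n n ℂ) (w : n → ℂ) : ℂ :=
  star v ⬝ᵥ (M *ᵥ w)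

/-- A state is classical with respect to the family of vectors `v` on the `A` side. -/
def ClassicalWrt {dA dB : ℕ} (v : Fin dA → Fin dA → ℂ)
    (ρ : Matrix (Fin dA × Fin dB) (Fin dA × Fin dB) ℂ) : Prop :=
  ∃ (lam : Fin dA → ℝ) (τ : Fin dA → Matrix (Fin dB) (Fin dB) ℂ),
    (∀ i, 0 ≤ lam i) ∧ (∀ i, IsState (τ i)) ∧
    ρ = ∑ i, ((lam i : ℂ) • (proj (v i) ⊗ₖ τ i))

/-- Orthonormality of a family of `dA` vectors of `ℂ^dA` (hence an orthonormal basis). -/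
def IsONBasis {d : ℕ} (v : Fin d → Fin d → ℂ) : Prop :=
  ∀ i j, star (v i) ⬝ᵥ v j = if i = j then 1 else 0

/-- A state is classical with respect to `A` if it is classical w.r.t. some
orthonormal basis of `ℂ^dA`; otherwise it is discordant. -/
def ClassicalA {dA dB : ℕ} (ρ : Matrix (Fin dA × Fin dB) (Fin dA × Fin dB) ℂ) : Prop :=
  ∃ v : Fin dA → Fin dA → ℂ, IsONBasis v ∧ ClassicalWrt v ρ

/-- Hamming weight of a natural number (number of ones in binary). -/
def hammingWt (n : ℕ) : ℕ := (Nat.digits 2 n).sum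

theorem Matrix.PosSemidef.apply_eq_zero_of_diag_eq_zero {n : Type*} [Fintype n] [DecidableEq n]
    {A : Matrix n n ℂ} (hA : A.PosSemidef) {i : n} (h : A i i = 0) (j : n) :
    A j i = 0 ∧ A i j = 0 := by
  have hcol : A *ᵥ Pi.single i 1 = 0 := by
    rw [← hA.dotProduct_mulVec_zero_iff, mulVec_single_one]
    simp [Pi.star_single, h]
  have hji : A j i = 0 := by
    rw [mulVec_single_one] at hcol
    exact congrFun hcol j
  exact ⟨hji, by rw [← hA.isHermitian.apply, hji, star_zero]⟩

/-- A separable state with `⟨ij|ρ|ij⟩ = 0` satisfies `⟨il|ρ|kj⟩ = 0`. -/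
theorem SeparableState.apply_eq_zero_of_diag_eq_zero {dA dB : ℕ}
    {ρ : Matrix (Fin dA × Fin dB) (Fin dA × Fin dB) ℂ} (hρ : SeparableState ρ)
    {i : Fin dA} {j : Fin dB} (h : ρ (i, j) (i, j) = 0) (k : Fin dA) (l : Fin dB) :
    ρ (i, l) (k, j) = 0 := by
  obtain ⟨m, p, A, B, hp, -, hA, hB, rfl⟩ := hρ
  simp only [Matrix.sum_apply, Matrix.smul_apply, kroneckerMap_apply, smul_eq_mul] at h ⊢
  have hnonneg : ∀ x ∈ Finset.univ, 0 ≤ (p x : ℂ) * (A x i i * B x j j) := fun x _ =>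
    mul_nonneg (by exact_mod_cast hp x) (mul_nonneg (hA x).1.diag_nonneg (hB x).1.diag_nonneg)
  refine Finset.sum_eq_zero fun x hx => ?_
  have hx0 := (Finset.sum_eq_zero_iff_of_nonneg hnonneg).1 h x hx
  rcases mul_eq_zero.1 hx0 with h0 | h0
  · simp [h0]
  rcases mul_eq_zero.1 h0 with h0 | h0
  · simp [((hA x).1.apply_eq_zero_of_diag_eq_zero h0 k).2]
  · simp [((hB x).1.apply_eq_zero_of_diag_eq_zero h0 l).1]

theorem isState_proj {n : Type*} [Fintype n] [DecidableEq n] {v : n → ℂ}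
    (hv : v ⬝ᵥ star v = 1) : IsState (proj v) :=
  ⟨posSemidef_vecMulVec_self_star v, by rw [proj, trace_vecMulVec, hv]⟩

theorem IsState.mix {n : Type*} [Fintype n] [DecidableEq n] {ρ τ : Matrix n n ℂ}
    (hρ : IsState ρ) (hτ : IsState τ) {ε : ℝ} (h0 : 0 ≤ ε) (h1 : ε ≤ 1) :
    IsState ((1 - (ε : ℂ)) • ρ + (ε : ℂ) • τ) := by
  have h1' : (0 : ℂ) ≤ 1 - (ε : ℂ) := by exact_mod_cast sub_nonneg.2 h1
  refine ⟨(hρ.1.smul h1').add (hτ.1.smul (by exact_mod_cast h0)), ?_⟩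
  simp [hρ.2, hτ.2]

theorem Matrix.IsHermitian.sum_abs_eigenvalues_le {n : Type*} [Fintype n] [DecidableEq n]
    {M P Q : Matrix n n ℂ} (hM : M.IsHermitian) (hP : P.PosSemidef) (hQ : Q.PosSemidef)
    (h : M = P - Q) : ∑ i, |hM.eigenvalues i| ≤ (P.trace + Q.trace).re := by
  set U : Matrix n n ℂ := (hM.eigenvectorUnitary : Matrix n n ℂ)
  have hU : U * Uᴴ = 1 := Unitary.coe_mul_star_self hM.eigenvectorUnitary
  have htr (X : Matrix n n ℂ) : (Uᴴ * X * U).trace = X.trace := by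
    rw [trace_mul_comm, ← mul_assoc, hU, one_mul]
  have hdiag : Uᴴ * P * U - Uᴴ * Q * U = diagonal (RCLike.ofReal ∘ hM.eigenvalues) := by
    rw [← sub_mul, ← mul_sub, ← h, ← hM.conjStarAlgAut_star_eigenvectorUnitary]
    simp [Unitary.conjStarAlgAut_apply, U, star_eq_conjTranspose]
  rw [← htr P, ← htr Q, trace, trace, ← Finset.sum_add_distrib, Complex.re_sum]
  refine Finset.sum_le_sum fun i _ => ?_
  have hp := (Complex.nonneg_iff.1 ((hP.conjTranspose_mul_mul_same U).diag_nonneg (i := i))).1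
  have hq := (Complex.nonneg_iff.1 ((hQ.conjTranspose_mul_mul_same U).diag_nonneg (i := i))).1
  have he := congrArg Complex.re (congrFun (congrFun hdiag i) i)
  simp only [Matrix.sub_apply, Complex.sub_re, diagonal_apply_eq, Function.comp_apply,
    RCLike.ofReal_eq_complex_ofReal, Complex.ofReal_re] at he
  simp only [diag_apply, Complex.add_re]
  rw [abs_le]
  constructor <;> linarith

theorem traceDist_mix_le {n : Type*} [Fintype n] [DecidableEq n] {ρ τ : Matrix n n ℂ}
    (hρ : IsState ρ) (hτ : IsState τ) {ε : ℝ} (h0 : 0 ≤ ε) :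
    traceDist ρ ((1 - (ε : ℂ)) • ρ + (ε : ℂ) • τ) ≤ ε := by
  unfold traceDist
  split_ifs with h
  · have hε : (0 : ℂ) ≤ (ε : ℂ) := by exact_mod_cast h0
    have key := h.sum_abs_eigenvalues_le (hρ.1.smul hε) (hτ.1.smul hε) (by module)
    simp only [trace_smul, hρ.2, hτ.2, smul_eq_mul, mul_one, Complex.add_re,
      Complex.ofReal_re] at key
    linarith
  · exact h0

theorem ofReal_sqrt_two_inv_mul_self :
    ((Real.sqrt 2 : ℂ))⁻¹ * ((Real.sqrt 2 : ℂ))⁻¹ = 2⁻¹ := by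
  rw [← mul_inv, ← Complex.ofReal_mul, Real.mul_self_sqrt zero_le_two, Complex.ofReal_ofNat]

/-- for `ρ = λ₀₁|01⟩⟨01| + λ₁₊|1+⟩⟨1+| + λ₁₋|1−⟩⟨1−|` the states
`ρ_ε = (1−ε)ρ + ε|ψ₊⟩⟨ψ₊|` are entangled with `δ(ρ, ρ_ε) ≤ ε`; hence there are
entangled states arbitrarily close to `ρ`. -/
theorem stmt_6 (l01 l1p l1m : ℝ) (h01 : 0 ≤ l01) (h1p : 0 ≤ l1p) (h1m : 0 ≤ l1m)
    (hsum : l01 + l1p + l1m = 1)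
    (ρ : Matrix (Fin 2 × Fin 2) (Fin 2 × Fin 2) ℂ)
    (hρ : ρ = (l01 : ℂ) • proj (vecKron (ket2 0) (ket2 1)) +
        (l1p : ℂ) • proj (vecKron (ket2 1) ketPlus) +
        (l1m : ℂ) • proj (vecKron (ket2 1) ketMinus)) :
    (∀ ε : ℝ, 0 < ε → ε ≤ 1 →
      EntangledState ((1 - (ε : ℂ)) • ρ + (ε : ℂ) • proj psiPlus) ∧
      traceDist ρ ((1 - (ε : ℂ)) • ρ + (ε : ℂ) • proj psiPlus) ≤ ε) ∧
    (∀ ε : ℝ, 0 < ε → ∃ σ, EntangledState σ ∧ traceDist ρ σ ≤ ε) := by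
  have hs := ofReal_sqrt_two_inv_mul_self
  have hψ : IsState (proj psiPlus) := isState_proj <| by
    simp [dotProduct, Fintype.sum_prod_type, psiPlus, vecKron, ket2, hs]
    norm_num
  have h1 : IsState (proj (vecKron (ket2 0) (ket2 1))) := isState_proj <| by
    simp [dotProduct, Fintype.sum_prod_type, vecKron, ket2]
  have h2 : IsState (proj (vecKron (ket2 1) ketPlus)) := isState_proj <| by
    simp [dotProduct, Fintype.sum_prod_type, vecKron, ketPlus, ket2, hs]
    norm_num
  have h3 : IsState (proj (vecKron (ket2 1) ketMinus)) := isState_proj <| by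
    simp [dotProduct, Fintype.sum_prod_type, vecKron, ketMinus, ket2, hs]
    norm_num
  have hρs : IsState ρ := by
    subst hρ
    refine ⟨((h1.1.smul (by exact_mod_cast h01)).add (h2.1.smul (by exact_mod_cast h1p))).add
      (h3.1.smul (by exact_mod_cast h1m)), ?_⟩
    simp only [trace_add, trace_smul, h1.2, h2.2, h3.2, smul_eq_mul, mul_one]
    exact_mod_cast hsum
  have main : ∀ ε : ℝ, 0 < ε → ε ≤ 1 →
      EntangledState ((1 - (ε : ℂ)) • ρ + (ε : ℂ) • proj psiPlus) ∧
      traceDist ρ ((1 - (ε : ℂ)) • ρ + (ε : ℂ) • proj psiPlus) ≤ ε := by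
    refine fun ε h0 hle => ⟨⟨hρs.mix hψ h0.le hle, fun hsep => ?_⟩, traceDist_mix_le hρs hψ h0.le⟩
    have hzero := hsep.apply_eq_zero_of_diag_eq_zero (i := 0) (j := 0)
      (by simp [hρ, proj, vecMulVec_apply, psiPlus, vecKron, ket2]) 1 1
    simp [hρ, proj, vecMulVec_apply, psiPlus, vecKron, ket2, h0.ne'] at hzero
  refine ⟨main, fun ε h0 => ?_⟩
  obtain ⟨hent, hdist⟩ := main (min ε 1) (lt_min h0 one_pos) (min_le_right _ _)
  exact ⟨_, hent, hdist.trans (min_le_left _ _)⟩
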